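/- arXiv:1908.01661 — 5 statements merged into one kernel-verified Lean document; each statement's English description precedes it below -/
import Mathlib

section
/- For every logic L: truth is implicitly definable in Mod* L if and only if for every algebra A the Leibniz operator Ω^A is injective on Fi_L A; and truth is almost implicitly definable in Mod* L if and only if for every algebra A the Leibniz operator Ω^A is injective on Fi_L A ∖ {∅}. -/
universe u

/-- An algebraic type (signature): a set of function symbols with finite arities. -/
structure AlgSig : Type (u + 1) where
  F : Type u
  ar : F → ℕ

/-- Terms (formulas) over a signature, with a countably infinite set `ℕ` of variables. -/
inductive Trm (S : AlgSig.{u}) : Type u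
  | var : ℕ → Trm S
  | app : (f : S.F) → (Fin (S.ar f) → Trm S) → Trm S

/-- An algebra of a given signature. -/
structure AlgStr (S : AlgSig.{u}) : Type (u + 1) where
  α : Type u
  op : (f : S.F) → (Fin (S.ar f) → α) → α

variable {S : AlgSig.{u}}

/-- Evaluation of a term in an algebra under a valuation (equivalently, the unique
homomorphism from the term algebra determined by the valuation). -/
def Trm.eval (A : AlgStr S) (v : ℕ → A.α) : Trm S → A.α
  | .var n => v n
  | .app f t => A.op f fun i => Trm.eval A v (t i)

/-- Substitution (an endomorphism of the term algebra). -/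
def Trm.subst (σ : ℕ → Trm S) : Trm S → Trm S
  | .var n => σ n
  | .app f t => .app f fun i => Trm.subst σ (t i)

/-- All variables occurring in the term are `< n`. -/
def Trm.varsLT (n : ℕ) : Trm S → Prop
  | .var m => m < n
  | .app _ t => ∀ i, Trm.varsLT n (t i)

/-- The absolutely free term algebra `Fm`. -/
def TrmAlg (S : AlgSig.{u}) : AlgStr S :=
  ⟨Trm S, Trm.app⟩

/-- A congruence of an algebra. -/
def IsCong (A : AlgStr S) (θ : A.α → A.α → Prop) : Prop :=
  Equivalence θ ∧
    ∀ (f : S.F) (x y : Fin (S.ar f) → A.α), (∀ i, θ (x i) (y i)) → θ (A.op f x) (A.op f y)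

/-- A relation is compatible with a subset `F`. -/
def CompatWith {β : Type u} (θ : β → β → Prop) (F : Set β) : Prop :=
  ∀ a b, θ a b → a ∈ F → b ∈ F

/-- The Leibniz congruence `Ω^A F`: the largest congruence of `A` compatible with `F`
(the union of all congruences compatible with `F`). -/
def Leibniz (A : AlgStr S) (F : Set A.α) : A.α → A.α → Prop :=
  fun a b => ∃ θ, IsCong A θ ∧ CompatWith θ F ∧ θ a b

/-- A matrix `⟨A, F⟩` is reduced if its Leibniz congruence is the identity relation. -/
def IsReducedMatrix (A : AlgStr S) (F : Set A.α) : Prop :=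
  ∀ a b, Leibniz A F a b ↔ a = b

/-- A logic: a structural closure operator on sets of formulas. -/
structure Logic (S : AlgSig.{u}) where
  C : Set (Trm S) → Set (Trm S)
  monotone : ∀ ⦃Γ Δ : Set (Trm S)⦄, Γ ⊆ Δ → C Γ ⊆ C Δ
  extensive : ∀ Γ, Γ ⊆ C Γ
  idem : ∀ Γ, C (C Γ) ⊆ C Γ
  structural : ∀ (σ : ℕ → Trm S) (Γ : Set (Trm S)),
    Trm.subst σ '' C Γ ⊆ C (Trm.subst σ '' Γ)

/-- Deductive filter of a logic over an algebra. -/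
def IsDedFilter (Lo : Logic S) (A : AlgStr S) (Fl : Set A.α) : Prop :=
  ∀ (Γ : Set (Trm S)) (φ : Trm S), φ ∈ Lo.C Γ →
    ∀ v : ℕ → A.α, (∀ γ ∈ Γ, Trm.eval A v γ ∈ Fl) → Trm.eval A v φ ∈ Fl

/-- Theories of a logic: the deductive filters over the term algebra. -/
def Theories (Lo : Logic S) : Set (Set (Trm S)) :=
  {Γ | IsDedFilter Lo (TrmAlg S) Γ}

/-- The deductive filter generated by a set. -/
def FgFilter (Lo : Logic S) (A : AlgStr S) (X : Set A.α) : Set A.α :=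
  {a | ∀ G, IsDedFilter Lo A G → X ⊆ G → a ∈ G}

/-- The Suszko congruence of `F` relative to a logic: the intersection of the Leibniz
congruences of all deductive filters extending `F`. -/
def Suszko (Lo : Logic S) (A : AlgStr S) (F : Set A.α) : A.α → A.α → Prop :=
  fun a b => ∀ G, IsDedFilter Lo A G → F ⊆ G → Leibniz A G a b

/-- Unary polynomial functions of an algebra. -/
def IsUnaryPoly (A : AlgStr S) (p : A.α → A.α) : Prop :=
  ∃ (φ : Trm S) (v : ℕ → A.α), ∀ a, p a = Trm.eval A (Function.update v 0 a) φ

/-- The set of solutions `τ(A)` of a parametrized equational translation `τ(x, ȳ)`,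
where the distinguished variable `x` is variable `0` and the parameters are bound by a
universal quantifier. -/
def solSet (A : AlgStr S) (τ : Set (Trm S × Trm S)) : Set A.α :=
  {a | ∀ (v : ℕ → A.α), ∀ e ∈ τ,
    Trm.eval A (Function.update v 0 a) e.1 = Trm.eval A (Function.update v 0 a) e.2}

/-- `τ` defines truth in `Mod* L`. -/
def DefinesTruth (Lo : Logic S) (τ : Set (Trm S × Trm S)) : Prop :=
  ∀ (A : AlgStr S) (F : Set A.α), IsDedFilter Lo A F → IsReducedMatrix A F →
    solSet A τ = F

/-- `τ` almost defines truth in `Mod* L` (i.e. on its non-almost-trivial members). -/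
def AlmostDefinesTruth (Lo : Logic S) (τ : Set (Trm S × Trm S)) : Prop :=
  ∀ (A : AlgStr S) (F : Set A.α), IsDedFilter Lo A F → IsReducedMatrix A F →
    F.Nonempty → solSet A τ = F

/-- Only the distinguished variable `x` (variable `0`) occurs: no parameters. -/
def Trm.noParams : Trm S → Prop
  | .var n => n = 0
  | .app _ t => ∀ i, Trm.noParams (t i)

/-- An equational translation: a set of equations in the single variable `x`. -/
def IsEqTranslation (τ : Set (Trm S × Trm S)) : Prop :=
  ∀ e ∈ τ, Trm.noParams e.1 ∧ Trm.noParams e.2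

/-- The quotient of an algebra by a relation (intended: by a congruence). -/
noncomputable def quotAlg (A : AlgStr S) (r : A.α → A.α → Prop) : AlgStr S :=
  ⟨Quot r, fun f x => Quot.mk r (A.op f fun i => (x i).out)⟩
variable {S : AlgSig.{u}}

/-- Homomorphisms between algebras of the same signature. -/
structure AlgHomS (A B : AlgStr S) where
  toFun : A.α → B.α
  map_op : ∀ (f : S.F) (x : Fin (S.ar f) → A.α),
    toFun (A.op f x) = B.op f fun i => toFun (x i)

/-- The Leibniz operator is completely order-reflecting on a family `X` of subsets. -/
def ComplOrderReflOn (A : AlgStr S) (X : Set (Set A.α)) : Prop :=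
  ∀ (Fam : Set (Set A.α)) (G : Set A.α), Fam ⊆ X → G ∈ X →
    (∀ a b, (∀ F ∈ Fam, Leibniz A F a b) → Leibniz A G a b) → ⋂₀ Fam ⊆ G

/-- A Fregean logic: every Frege relation `Λ_L Γ` is a congruence of the term algebra. -/
def Fregean (Lo : Logic S) : Prop :=
  ∀ Γ : Set (Trm S),
    IsCong (TrmAlg S) fun φ ψ => ψ ∈ Lo.C (Γ ∪ {φ}) ∧ φ ∈ Lo.C (Γ ∪ {ψ})

/-- A protoalgebraic logic: there is a set `Δ(x,y)` of formulas in two variables with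
`∅ ⊢ Δ(x,x)` and `{x} ∪ Δ(x,y) ⊢ y`. -/
def Protoalgebraic (Lo : Logic S) : Prop :=
  ∃ Δ : Set (Trm S), (∀ d ∈ Δ, Trm.varsLT 2 d) ∧
    (∀ d ∈ Δ, Trm.subst (fun _ => Trm.var 0) d ∈ Lo.C ∅) ∧
    Trm.var 1 ∈ Lo.C ({Trm.var 0} ∪ Δ)

/-- The binary term `a ∧ b` built from a binary function symbol `m`. -/
def binT (m : S.F) (hm : S.ar m = 2) (a b : Trm S) : Trm S :=
  Trm.app m fun i => ![a, b] (Fin.cast hm i)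

/-- The binary operation of an algebra induced by a binary function symbol `m`. -/
def binA (A : AlgStr S) (m : S.F) (hm : S.ar m = 2) (a b : A.α) : A.α :=
  A.op m fun i => ![a, b] (Fin.cast hm i)

/-- A subuniverse (universe of a subalgebra). -/
def Subuniv (A : AlgStr S) (B : Set A.α) : Prop :=
  ∀ (f : S.F) (x : Fin (S.ar f) → A.α), (∀ i, x i ∈ B) → A.op f x ∈ B

/-- The subuniverse generated by a set. -/
def Sg (A : AlgStr S) (X : Set A.α) : Set A.α :=
  ⋂₀ {B | Subuniv A B ∧ X ⊆ B}

/-- A subuniverse is `κ`-generated if it is generated by a subset of cardinality `≤ κ`. -/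
def KGenerated (A : AlgStr S) (κ : Cardinal.{u}) (B : Set A.α) : Prop :=
  ∃ X : Set A.α, Cardinal.mk X ≤ κ ∧ Sg A X = B

/-- The subalgebra with universe a given subuniverse. -/
def subAlg (A : AlgStr S) (B : Set A.α) (hB : Subuniv A B) : AlgStr S :=
  ⟨B, fun f x => ⟨A.op f fun i => (x i).1, hB f _ fun i => (x i).2⟩⟩

/-- The signature expanded with a single new constant symbol `1`. -/
def expSig (S : AlgSig.{u}) : AlgSig.{u} :=
  ⟨S.F ⊕ PUnit, Sum.elim S.ar fun _ => 0⟩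

/-- The inclusion of the original terms into the terms of the expanded signature. -/
def Trm.incl : Trm S → Trm (expSig S)
  | .var n => .var n
  | .app f t => .app (Sum.inl f) fun i => Trm.incl (t i)
theorem aux_eq_cong (A : AlgStr S) : IsCong A (fun a b => a = b) :=
  ⟨⟨fun _ => rfl, fun h => h.symm, fun h k => h.trans k⟩, fun f x y h => by
    have : x = y := funext h
    rw [this]⟩

theorem aux_coord {n : ℕ} {β γ : Type u} (g : (Fin n → β) → γ) (r : γ → γ → Prop)
    (hrefl : ∀ a, r a a) (htrans : ∀ a b c, r a b → r b c → r a c) (s : β → β → Prop)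
    (hs : ∀ (z : Fin n → β) (i : Fin n) (b : β), s (z i) b →
      r (g z) (g (Function.update z i b)))
    (x y : Fin n → β) (h : ∀ i, s (x i) (y i)) : r (g x) (g y) := by
  have key : ∀ t : Finset (Fin n), r (g x) (g (t.piecewise y x)) := by
    intro t
    induction t using Finset.induction_on with
    | empty => simpa using hrefl _
    | insert j t hj ih =>
      rw [Finset.piecewise_insert]
      refine htrans _ _ _ ih (hs _ j _ ?_)
      rw [Finset.piecewise_eq_of_notMem _ _ _ hj]
      exact h j
  simpa using key Finset.univ

theorem aux_trans_cong (A : AlgStr S) (F : Set A.α) :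
    IsCong A (Relation.TransGen (Leibniz A F)) ∧
      CompatWith (Relation.TransGen (Leibniz A F)) F := by
  have hrefl : ∀ a, Relation.TransGen (Leibniz A F) a a := fun a =>
    Relation.TransGen.single ⟨_, aux_eq_cong A, fun a b h ha => h ▸ ha, rfl⟩
  refine ⟨⟨⟨hrefl, ?_, fun h k => h.trans k⟩, ?_⟩, ?_⟩
  · intro a b h
    induction h with
    | single h =>
      obtain ⟨θ, h1, h2, h3⟩ := h
      exact Relation.TransGen.single ⟨θ, h1, h2, h1.1.symm h3⟩
    | tail _ h ih =>
      obtain ⟨θ, h1, h2, h3⟩ := h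
      exact (Relation.TransGen.single ⟨θ, h1, h2, h1.1.symm h3⟩).trans ih
  · intro f x y h
    refine aux_coord (A.op f) _ hrefl (fun a b c h k => h.trans k) _ ?_ x y h
    intro z i b hb
    have step : ∀ c d, Leibniz A F c d →
        Leibniz A F (A.op f (Function.update z i c)) (A.op f (Function.update z i d)) := by
      rintro c d ⟨θ, h1, h2, h3⟩
      refine ⟨θ, h1, h2, h1.2 _ _ _ fun j => ?_⟩
      by_cases hj : j = i
      · subst hj; simpa using h3
      · simpa [hj] using h1.1.refl _
    have := Relation.TransGen.lift (fun c => A.op f (Function.update z i c)) step _ _ hb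
    simpa [Function.onFun] using this
  · intro a b h ha
    induction h with
    | single h =>
      obtain ⟨θ, h1, h2, h3⟩ := h
      exact h2 _ _ h3 ha
    | tail _ h ih =>
      obtain ⟨θ, h1, h2, h3⟩ := h
      exact h2 _ _ h3 ih

theorem aux_leibniz (A : AlgStr S) (F : Set A.α) :
    IsCong A (Leibniz A F) ∧ CompatWith (Leibniz A F) F := by
  have h := aux_trans_cong A F
  have e : Relation.TransGen (Leibniz A F) = Leibniz A F := by
    funext a b
    exact propext ⟨fun k => ⟨_, h.1, h.2, k⟩, Relation.TransGen.single⟩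
  rwa [e] at h

theorem aux_mk_eq {A : AlgStr S} {θ : A.α → A.α → Prop} (hθ : IsCong A θ) (a b : A.α) :
    Quot.mk θ a = Quot.mk θ b ↔ θ a b :=
  ⟨fun h => by
    have := Quot.eqvGen_exact h
    rwa [hθ.1.eqvGen_iff] at this, fun h => Quot.sound h⟩

theorem aux_mk_op {A : AlgStr S} {θ : A.α → A.α → Prop} (hθ : IsCong A θ) (f : S.F)
    (x : Fin (S.ar f) → A.α) :
    (quotAlg A θ).op f (fun i => (Quot.mk θ (x i) : Quot θ)) = Quot.mk θ (A.op f x) := by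
  refine (aux_mk_eq hθ _ _).2 (hθ.2 _ _ _ fun i => ?_)
  exact (aux_mk_eq hθ _ _).1 (Quot.out_eq _)

theorem aux_eval {A : AlgStr S} {θ : A.α → A.α → Prop} (hθ : IsCong A θ) (v : ℕ → A.α)
    (φ : Trm S) :
    Trm.eval (quotAlg A θ) (fun n => (Quot.mk θ (v n) : Quot θ)) φ
      = Quot.mk θ (Trm.eval A v φ) := by
  induction φ with
  | var n => rfl
  | app f t ih =>
    simp only [Trm.eval]
    rw [← aux_mk_op hθ]
    congr 1
    funext i
    exact ih i

/-- Image of a set in the quotient. -/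
def auxImg (A : AlgStr S) (θ : A.α → A.α → Prop) (F : Set A.α) : Set (quotAlg A θ).α :=
  {q | ∃ a ∈ F, Quot.mk θ a = q}

theorem aux_mem {A : AlgStr S} {θ : A.α → A.α → Prop} (hθ : IsCong A θ) {F : Set A.α}
    (hF : CompatWith θ F) (a : A.α) : (Quot.mk θ a : Quot θ) ∈ auxImg A θ F ↔ a ∈ F :=
  ⟨fun ⟨b, hb, h⟩ => hF _ _ ((aux_mk_eq hθ _ _).1 h) hb, fun h => ⟨a, h, rfl⟩⟩

theorem aux_filter (Lo : Logic S) {A : AlgStr S} {θ : A.α → A.α → Prop} (hθ : IsCong A θ)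
    {F : Set A.α} (hF : CompatWith θ F) (h : IsDedFilter Lo A F) :
    IsDedFilter Lo (quotAlg A θ) (auxImg A θ F) := by
  intro Γ φ hφ v hv
  obtain ⟨w, rfl⟩ : ∃ w : ℕ → A.α, v = fun n => (Quot.mk θ (w n) : Quot θ) :=
    ⟨fun n => Quot.out (v n), funext fun n => (Quot.out_eq _).symm⟩
  rw [aux_eval hθ]
  refine (aux_mem hθ hF _).2 (h Γ φ hφ w fun γ hγ => ?_)
  have := hv γ hγ
  rw [aux_eval hθ] at this
  exact (aux_mem hθ hF _).1 this

theorem aux_reduced {A : AlgStr S} {F : Set A.α} {θ : A.α → A.α → Prop} (e : Leibniz A F = θ) :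
    IsReducedMatrix (quotAlg A θ) (auxImg A θ F) := by
  obtain ⟨hθ, hF⟩ : IsCong A θ ∧ CompatWith θ F := e ▸ aux_leibniz A F
  intro p q
  constructor
  · rintro ⟨ψ, h1, h2, h3⟩
    obtain ⟨a, rfl⟩ := Quot.exists_rep p
    obtain ⟨b, rfl⟩ := Quot.exists_rep q
    refine (aux_mk_eq hθ _ _).2 ?_
    rw [← e]
    refine ⟨fun a b => ψ (Quot.mk θ a) (Quot.mk θ b),
      ⟨⟨fun _ => h1.1.refl _, fun h => h1.1.symm h, fun h k => h1.1.trans h k⟩, ?_⟩, ?_, h3⟩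
    · intro f x y h
      have := h1.2 f (fun i => (Quot.mk θ (x i) : Quot θ)) (fun i => (Quot.mk θ (y i) : Quot θ)) h
      rwa [aux_mk_op hθ, aux_mk_op hθ] at this
    · intro a b h ha
      exact (aux_mem hθ hF _).1 (h2 _ _ h ((aux_mem hθ hF _).2 ha))
  · rintro rfl
    exact ⟨_, aux_eq_cong _, fun a b h ha => h ▸ ha, rfl⟩

theorem aux_inj {A : AlgStr S} {F G : Set A.α} (e : Leibniz A F = Leibniz A G)
    (h : auxImg A (Leibniz A G) F = auxImg A (Leibniz A G) G) : F = G := by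
  have hG := aux_leibniz A G
  have hF := aux_leibniz A F
  rw [e] at hF
  ext a
  rw [← aux_mem hF.1 hF.2, h, aux_mem hG.1 hG.2]

theorem aux_red_eq {A : AlgStr S} {F G : Set A.α} (hF : IsReducedMatrix A F)
    (hG : IsReducedMatrix A G) : Leibniz A F = Leibniz A G := by
  funext a b
  exact propext ((hF a b).trans (hG a b).symm)

/-- truth is implicitly definable in `Mod* L` iff the Leibniz operator is
injective on `Fi_L A` for every algebra `A`; and truth is almost implicitly definable
in `Mod* L` iff the Leibniz operator is injective on `Fi_L A ∖ {∅}` for every `A`. -/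
theorem implicitlyDefinable_iff_injective {S : AlgSig.{u}} (Lo : Logic S) :
    ((∀ (A : AlgStr S) (F G : Set A.α),
        IsDedFilter Lo A F → IsReducedMatrix A F →
        IsDedFilter Lo A G → IsReducedMatrix A G → F = G) ↔
      ∀ (A : AlgStr S) (F G : Set A.α), IsDedFilter Lo A F → IsDedFilter Lo A G →
        Leibniz A F = Leibniz A G → F = G) ∧
    ((∀ (A : AlgStr S) (F G : Set A.α),
        IsDedFilter Lo A F → IsReducedMatrix A F → F.Nonempty →
        IsDedFilter Lo A G → IsReducedMatrix A G → G.Nonempty → F = G) ↔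
      ∀ (A : AlgStr S) (F G : Set A.α),
        IsDedFilter Lo A F → F.Nonempty → IsDedFilter Lo A G → G.Nonempty →
        Leibniz A F = Leibniz A G → F = G) := by
  refine ⟨⟨fun H A F G hF hG e => ?_, fun H A F G hF rF hG rG => H A F G hF hG (aux_red_eq rF rG)⟩,
    ⟨fun H A F G hF nF hG nG e => ?_,
      fun H A F G hF rF nF hG rG nG => H A F G hF nF hG nG (aux_red_eq rF rG)⟩⟩
  · have kG := aux_leibniz A G
    have kF := aux_leibniz A F
    rw [e] at kF
    exact aux_inj e (H _ _ _ (aux_filter Lo kF.1 kF.2 hF) (aux_reduced e)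
      (aux_filter Lo kG.1 kG.2 hG) (aux_reduced rfl))
  · have kG := aux_leibniz A G
    have kF := aux_leibniz A F
    rw [e] at kF
    obtain ⟨a, ha⟩ := nF
    obtain ⟨b, hb⟩ := nG
    exact aux_inj e (H _ _ _ (aux_filter Lo kF.1 kF.2 hF) (aux_reduced e) ⟨_, a, ha, rfl⟩
      (aux_filter Lo kG.1 kG.2 hG) (aux_reduced rfl) ⟨_, b, hb, rfl⟩)
end

section
/- Let L be a protoalgebraic logic such that the Leibniz operator Ω is injective on Th L. Then for every algebra A, the Leibniz operator Ω^A is injective on Fi_L A. (For protoalgebraic logics the injectivity of the Leibniz operator transfers from theories to filters over arbitrary algebras.) -/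
universe u

variable {S : AlgSig.{u}}

variable {S : AlgSig.{u}}

theorem eval_TrmAlg (σ : ℕ → Trm S) (t : Trm S) :
    Trm.eval (TrmAlg S) σ t = Trm.subst σ t := by
  induction t with
  | var n => rfl
  | app f t ih =>
    simp only [Trm.eval, Trm.subst, TrmAlg]
    congr 1
    funext i
    exact ih i

theorem eval_subst (A : AlgStr S) (v : ℕ → A.α) (σ : ℕ → Trm S) (t : Trm S) :
    Trm.eval A v (Trm.subst σ t) = Trm.eval A (fun n => Trm.eval A v (σ n)) t := by
  induction t with
  | var n => rfl
  | app f t ih =>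
    simp only [Trm.eval, Trm.subst]
    congr 1
    funext i
    exact ih i

theorem eval_congr_lt (A : AlgStr S) (v w : ℕ → A.α) (N : ℕ) (h : ∀ n < N, v n = w n)
    (t : Trm S) (ht : Trm.varsLT N t) : Trm.eval A v t = Trm.eval A w t := by
  induction t with
  | var n => exact h n ht
  | app f t ih =>
    simp only [Trm.eval]
    congr 1
    funext i
    exact ih i (ht i)

theorem varsLT_mono {N M : ℕ} (h : N ≤ M) (t : Trm S) (ht : Trm.varsLT N t) :
    Trm.varsLT M t := by
  induction t with
  | var n => exact lt_of_lt_of_le ht h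
  | app f t ih => exact fun i => ih i (ht i)

theorem exists_varsLT (t : Trm S) : ∃ N, Trm.varsLT N t := by
  induction t with
  | var n => exact ⟨n + 1, Nat.lt_succ_self n⟩
  | app f t ih =>
    choose N hN using ih
    exact ⟨Finset.univ.sup N, fun i => varsLT_mono (Finset.le_sup (Finset.mem_univ i)) _ (hN i)⟩

theorem filter_of (Lo : Logic S) (T : Set (Trm S))
    (h : ∀ (Γ : Set (Trm S)) (φ : Trm S), φ ∈ Lo.C Γ → ∀ σ : ℕ → Trm S,
      (∀ γ ∈ Γ, Trm.subst σ γ ∈ T) → Trm.subst σ φ ∈ T) : IsDedFilter Lo (TrmAlg S) T := by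
  intro Γ φ hφ σ hσ
  exact Eq.mpr (congrArg (fun t : Trm S => t ∈ T) (eval_TrmAlg σ φ))
    (h Γ φ hφ σ fun γ hγ =>
      Eq.mp (congrArg (fun t : Trm S => t ∈ T) (eval_TrmAlg σ γ)) (hσ γ hγ))

theorem filter_preimage (Lo : Logic S) (A : AlgStr S) (F : Set A.α) (hF : IsDedFilter Lo A F)
    (v : ℕ → A.α) : IsDedFilter Lo (TrmAlg S) {t : Trm S | Trm.eval A v t ∈ F} := by
  apply filter_of
  intro Γ φ hφ σ hσ
  have h1 : ∀ γ ∈ Γ, Trm.eval A (fun n => Trm.eval A v (σ n)) γ ∈ F := by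
    intro γ hγ
    rw [← eval_subst]
    exact hσ γ hγ
  have h2 := hF Γ φ hφ _ h1
  rw [← eval_subst] at h2
  exact h2

theorem filter_C (Lo : Logic S) (X : Set (Trm S)) : IsDedFilter Lo (TrmAlg S) (Lo.C X) := by
  apply filter_of
  intro Γ φ hφ σ hσ
  apply Lo.idem
  refine Lo.monotone ?_ (Lo.structural σ Γ ⟨φ, hφ, rfl⟩)
  rintro _ ⟨γ, hγ, rfl⟩
  exact hσ γ hγ

theorem cong_eval (A : AlgStr S) (θ : A.α → A.α → Prop) (hθ : IsCong A θ) (v w : ℕ → A.α)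
    (h : ∀ n, θ (v n) (w n)) (t : Trm S) : θ (Trm.eval A v t) (Trm.eval A w t) := by
  induction t with
  | var n => exact h n
  | app f t ih => exact hθ.2 f _ _ ih

theorem compat_mono (Lo : Logic S) (hp : Protoalgebraic Lo) (A : AlgStr S) (H K : Set A.α)
    (hH : IsDedFilter Lo A H) (hK : IsDedFilter Lo A K) (hHK : H ⊆ K)
    (θ : A.α → A.α → Prop) (hθ : IsCong A θ) (hc : CompatWith θ H) : CompatWith θ K := by
  obtain ⟨Δ, -, h1, h2⟩ := hp
  intro a b hab ha
  let u : ℕ → A.α := fun n => if n = 0 then a else b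
  have := hK _ _ h2 u ?_
  · exact this
  · rintro γ (rfl | hγ)
    · exact ha
    · apply hHK
      refine hc (Trm.eval A (fun _ => a) γ) _ ?_ ?_
      · apply cong_eval A θ hθ
        intro n
        by_cases hn : n = 0
        · simp only [u, hn, if_true]; exact hθ.1.refl a
        · simp only [u, hn, if_false]; exact hab
      · have := hH _ _ (h1 γ hγ) (fun _ => a) (by simp)
        rwa [eval_subst] at this

inductive Transl (A : AlgStr S) : (A.α → A.α) → Prop
  | id : Transl A (fun b => b)
  | step (p : A.α → A.α) (f : S.F) (x : Fin (S.ar f) → A.α) (i : Fin (S.ar f)) :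
      Transl A p → Transl A (fun b => p (A.op f (Function.update x i b)))

def thetaF (A : AlgStr S) (F : Set A.α) (b c : A.α) : Prop :=
  ∀ p, Transl A p → (p b ∈ F ↔ p c ∈ F)

theorem thetaF_cong (A : AlgStr S) (F : Set A.α) : IsCong A (thetaF A F) := by
  have eqv : Equivalence (thetaF A F) :=
    ⟨fun _ _ _ => Iff.rfl, fun h p hp => (h p hp).symm,
      fun h h' p hp => (h p hp).trans (h' p hp)⟩
  refine ⟨eqv, ?_⟩
  intro f x y hxy
  have : ∀ s : Finset (Fin (S.ar f)),
      thetaF A F (A.op f x) (A.op f (fun i => if i ∈ s then y i else x i)) := by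
    intro s
    induction s using Finset.induction_on with
    | empty => simpa using eqv.refl _
    | insert i s hi ih =>
      refine eqv.trans ih ?_
      intro p hp
      have := hxy i _ (Transl.step p f (fun i => if i ∈ s then y i else x i) i hp)
      have e1 : Function.update (fun i => if i ∈ s then y i else x i) i (x i)
          = (fun i => if i ∈ s then y i else x i) := by
        funext j
        by_cases hj : j = i
        · subst hj; simp [hi]
        · simp [Function.update_of_ne hj]
      have e2 : Function.update (fun i => if i ∈ s then y i else x i) i (y i)
          = (fun j => if j ∈ insert i s then y j else x j) := by
        funext j
        by_cases hj : j = i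
        · subst hj; simp
        · simp [Function.update_of_ne hj, hj]
      rw [e1, e2] at this
      exact this
  simpa using this Finset.univ

theorem transl_key (Lo : Logic S) (hp : Protoalgebraic Lo) (A : AlgStr S) (F : Set A.α)
    (hF : IsDedFilter Lo A F) (θ : Trm S → Trm S → Prop) (hθ : IsCong (TrmAlg S) θ)
    (hc : CompatWith θ (Lo.C {Trm.var 0})) (p : A.α → A.α) (hT : Transl A p) :
    ∀ (ε δ : Trm S) (N : ℕ) (v : ℕ → A.α), 0 < N → v 0 ∈ F → Trm.varsLT N ε →
      Trm.varsLT N δ → θ ε δ → p (Trm.eval A v ε) ∈ F → p (Trm.eval A v δ) ∈ F := by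
  induction hT with
  | id =>
    intro ε δ N v _ h0 _ _ hεδ
    refine compat_mono Lo hp (TrmAlg S) (Lo.C {Trm.var 0}) {t : Trm S | Trm.eval A v t ∈ F}
      (filter_C Lo _) (filter_preimage Lo A F hF v) ?_ θ hθ hc ε δ hεδ
    intro t ht
    exact hF _ _ ht v (by rintro _ rfl; exact h0)
  | step p f x i _ ih =>
    intro ε δ N v hN h0 hε hδ hεδ
    let v' : ℕ → A.α := fun n =>
      if n < N then v n else if h : n - N < S.ar f then x ⟨n - N, h⟩ else v 0
    let g : Trm S → Trm S := fun t =>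
      Trm.app f (Function.update (fun j => Trm.var (N + j.1)) i t)
    have hv : ∀ t, Trm.varsLT N t → Trm.eval A v' t = Trm.eval A v t := by
      intro t ht
      apply eval_congr_lt A _ _ N _ t ht
      intro n hn
      simp [v', hn]
    have hg : ∀ t, Trm.varsLT N t →
        Trm.eval A v' (g t) = A.op f (Function.update x i (Trm.eval A v t)) := by
      intro t ht
      simp only [g, Trm.eval]
      congr 1
      funext j
      by_cases hj : j = i
      · subst hj; simp [hv t ht]
      · simp [Function.update_of_ne hj, Trm.eval, v']
    have hl : ∀ t, Trm.varsLT N t → Trm.varsLT (N + S.ar f) (g t) := by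
      intro t ht j
      by_cases hj : j = i
      · subst hj; simpa using varsLT_mono (Nat.le_add_right _ _) t ht
      · simp [Function.update_of_ne hj, Trm.varsLT]
    have := ih (g ε) (g δ) (N + S.ar f) v' (by omega) (by simpa [v', hN] using h0)
      (hl ε hε) (hl δ hδ) ?_
    · rwa [hg ε hε, hg δ hδ] at this
    · apply hθ.2 f
      intro j
      by_cases hj : j = i
      · subst hj; simpa using hεδ
      · simp only [Function.update_of_ne hj]; exact hθ.1.refl _

theorem order_refl (Lo : Logic S) (hp : Protoalgebraic Lo)
    (hinj : ∀ Γ Γ' : Set (Trm S), Γ ∈ Theories Lo → Γ' ∈ Theories Lo →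
      Leibniz (TrmAlg S) Γ = Leibniz (TrmAlg S) Γ' → Γ = Γ')
    (T U : Set (Trm S)) (hT : T ∈ Theories Lo) (hU : U ∈ Theories Lo)
    (h : ∀ a b, Leibniz (TrmAlg S) T a b → Leibniz (TrmAlg S) U a b) : T ⊆ U := by
  have hTU : T ∩ U ∈ Theories Lo := fun Γ φ hφ v hv =>
    ⟨hT Γ φ hφ v fun γ hγ => (hv γ hγ).1, hU Γ φ hφ v fun γ hγ => (hv γ hγ).2⟩
  have := hinj T (T ∩ U) hT hTU ?_
  · intro t ht
    rw [this] at ht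
    exact ht.2
  · funext a b
    apply propext
    constructor
    · rintro ⟨θ, hθ, hc, hab⟩
      refine ⟨θ, hθ, ?_, hab⟩
      intro s t hst hs
      obtain ⟨η, _, hc', hst'⟩ := h s t ⟨θ, hθ, hc, hst⟩
      exact ⟨hc s t hst hs.1, hc' s t hst' hs.2⟩
    · rintro ⟨θ, hθ, hc, hab⟩
      exact ⟨θ, hθ, compat_mono Lo hp (TrmAlg S) _ _ hTU hT Set.inter_subset_left θ hθ hc, hab⟩

theorem transfer_sub (Lo : Logic S) (hp : Protoalgebraic Lo)
    (hinj : ∀ Γ Γ' : Set (Trm S), Γ ∈ Theories Lo → Γ' ∈ Theories Lo →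
      Leibniz (TrmAlg S) Γ = Leibniz (TrmAlg S) Γ' → Γ = Γ')
    (A : AlgStr S) (F G : Set A.α) (hF : IsDedFilter Lo A F) (hG : IsDedFilter Lo A G)
    (h : Leibniz A F = Leibniz A G) : F ⊆ G := by
  intro a ha
  have := order_refl Lo hp hinj (Lo.C {Trm.var 0}) {t : Trm S | Trm.eval A (fun _ => a) t ∈ G}
    (filter_C Lo _) (filter_preimage Lo A G hG _) ?_ (Lo.extensive _ rfl)
  · exact this
  · rintro ε δ ⟨θ, hθ, hc, hεδ⟩
    have hl : Leibniz A F (Trm.eval A (fun _ => a) ε) (Trm.eval A (fun _ => a) δ) := by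
      refine ⟨thetaF A F, thetaF_cong A F, fun b c hbc => (hbc _ Transl.id).1, ?_⟩
      intro p hT
      obtain ⟨N, hN⟩ := exists_varsLT (S := S) ε
      obtain ⟨M, hM⟩ := exists_varsLT (S := S) δ
      have hN' := varsLT_mono (show N ≤ N + M + 1 by omega) _ hN
      have hM' := varsLT_mono (show M ≤ N + M + 1 by omega) _ hM
      have key := transl_key Lo hp A F hF θ hθ hc p hT
      exact ⟨key ε δ (N + M + 1) (fun _ => a) (by omega) ha hN' hM' hεδ,
        key δ ε (N + M + 1) (fun _ => a) (by omega) ha hM' hN' (hθ.1.symm hεδ)⟩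
    rw [h] at hl
    obtain ⟨η, hη, hcη, he⟩ := hl
    refine ⟨fun s t => η (Trm.eval A (fun _ => a) s) (Trm.eval A (fun _ => a) t),
      ⟨⟨fun _ => hη.1.refl _, fun h => hη.1.symm h, fun h h' => hη.1.trans h h'⟩, ?_⟩, ?_, he⟩
    · intro f x y hxy
      exact hη.2 f _ _ hxy
    · intro s t hst hs
      exact hcη _ _ hst hs

/-- for a protoalgebraic logic, injectivity of the Leibniz operator on
the theories transfers to the deductive filters over every algebra. -/
theorem protoalgebraic_injectivity_transfer {S : AlgSig.{u}} (Lo : Logic S)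
    (hp : Protoalgebraic Lo)
    (hinj : ∀ Γ Γ' : Set (Trm S), Γ ∈ Theories Lo → Γ' ∈ Theories Lo →
      Leibniz (TrmAlg S) Γ = Leibniz (TrmAlg S) Γ' → Γ = Γ') :
    ∀ (A : AlgStr S) (F G : Set A.α), IsDedFilter Lo A F → IsDedFilter Lo A G →
      Leibniz A F = Leibniz A G → F = G := by
  intro A F G hF hG h
  exact Set.Subset.antisymm (transfer_sub Lo hp hinj A F G hF hG h)
    (transfer_sub Lo hp hinj A G F hG hF h.symm)
end

section
/- Let κ be an infinite cardinal at least the cardinality of the set of function symbols of the algebraic type, and let ⟨A,F⟩ and ⟨A,G⟩ be reduced matrices over the same algebra A. Then every κ-generated subalgebra C of A can be extended to a κ-generated subalgebra B of A such that the matrices ⟨B, F ∩ B⟩ and ⟨B, G ∩ B⟩ are both reduced. -/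
universe u

variable {S : AlgSig.{u}}

variable {S : AlgSig.{u}}

/-- Unary translations with parameters in `P`. -/
inductive Trl (A : AlgStr S) (P : Set A.α) : (A.α → A.α) → Prop
  | id : Trl A P (fun z => z)
  | comp (t : A.α → A.α) (f : S.F) (x : Fin (S.ar f) → A.α) (i : Fin (S.ar f)) :
      Trl A P t → (∀ j, x j ∈ P) → Trl A P (fun z => t (A.op f (Function.update x i z)))

theorem Trl.mono {A : AlgStr S} {P Q : Set A.α} (h : P ⊆ Q) {t : A.α → A.α}
    (ht : Trl A P t) : Trl A Q t := by
  induction ht with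
  | id => exact Trl.id
  | comp t f x i _ hx ih => exact Trl.comp t f x i ih (fun j => h (hx j))

theorem Trl.countable {A : AlgStr S} {t : A.α → A.α}
    (ht : Trl A Set.univ t) : ∃ P : Set A.α, P.Countable ∧ Trl A P t := by
  induction ht with
  | id => exact ⟨∅, Set.countable_empty, Trl.id⟩
  | comp t f x i _ hx ih =>
    obtain ⟨P, hP, hPt⟩ := ih
    refine ⟨P ∪ Set.range x, hP.union (Set.countable_range x),
      Trl.comp t f x i (hPt.mono Set.subset_union_left) (fun j => Or.inr ⟨j, rfl⟩)⟩

theorem trl_sep {A : AlgStr S} {F : Set A.α} (hF : IsReducedMatrix A F) {a b : A.α}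
    (h : ∀ t, Trl A Set.univ t → (t a ∈ F ↔ t b ∈ F)) : a = b := by
  refine (hF a b).1 ⟨fun a b => ∀ t, Trl A Set.univ t → (t a ∈ F ↔ t b ∈ F), ⟨⟨?_, ?_, ?_⟩, ?_⟩,
    ?_, h⟩
  · intro x t _; exact Iff.rfl
  · intro x y h t ht; exact (h t ht).symm
  · intro x y z h1 h2 t ht; exact (h1 t ht).trans (h2 t ht)
  · intro f x y hxy t ht
    have key : ∀ s : Finset (Fin (S.ar f)),
        (t (A.op f x) ∈ F ↔ t (A.op f (s.piecewise y x)) ∈ F) := by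
      intro s
      induction s using Finset.induction_on with
      | empty => simp
      | insert j s hj ih =>
        rw [ih, Finset.piecewise_insert]
        have := hxy j _ (Trl.comp t f (s.piecewise y x) j ht (fun _ => trivial))
        have e : Function.update (s.piecewise y x) j (x j) = s.piecewise y x := by
          rw [Function.update_eq_self_iff]; simp [hj]
        simp only [e] at this
        exact this
    simpa using key Finset.univ
  · intro x y hxy hx
    exact (hxy _ Trl.id).1 hx

theorem exists_sep {A : AlgStr S} {F : Set A.α} (hF : IsReducedMatrix A F) (a b : A.α) :
    ∃ d : ℕ → A.α, a ≠ b → ∃ t, Trl A (Set.range d) t ∧ ¬ (t a ∈ F ↔ t b ∈ F) := by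
  by_cases hab : a = b
  · exact ⟨fun _ => a, fun h => absurd hab h⟩
  · have : ∃ t, Trl A Set.univ t ∧ ¬ (t a ∈ F ↔ t b ∈ F) := by
      by_contra hc
      push Not at hc
      exact hab (trl_sep hF (fun t ht => by have := hc t ht; tauto))
    obtain ⟨t, ht, hne⟩ := this
    obtain ⟨P, hP, hPt⟩ := ht.countable
    obtain ⟨d, hd⟩ := (hP.insert a).exists_eq_range ⟨a, Set.mem_insert _ _⟩
    exact ⟨d, fun _ => ⟨t, hPt.mono (hd ▸ Set.subset_insert a P), hne⟩⟩

theorem trl_cong {A : AlgStr S} {B : Set A.α} (hB : Subuniv A B)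
    {θ : B → B → Prop} (hθ : IsCong (subAlg A B hB) θ) {t : A.α → A.α} (ht : Trl A B t) :
    ∀ a b : B, θ a b → ∃ a' b' : B, a'.1 = t a.1 ∧ b'.1 = t b.1 ∧ θ a' b' := by
  induction ht with
  | id => intro a b h; exact ⟨a, b, rfl, rfl, h⟩
  | comp t f x i _ hx ih =>
    intro a b hab
    obtain ⟨y, hy1, hy2⟩ : ∃ y : B → Fin (S.ar f) → B, (∀ c, y c i = c) ∧
        ∀ c j, j ≠ i → y c j = ⟨x j, hx j⟩ :=
      ⟨fun c => Function.update (fun j => ⟨x j, hx j⟩) i c,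
        fun c => Function.update_self _ _ _, fun c j hj => Function.update_of_ne hj _ _⟩
    have h := hθ.2 f (y a) (y b) (by
      intro j
      by_cases hj : j = i
      · subst hj
        rw [hy1, hy1]; exact hab
      · rw [hy2 _ _ hj, hy2 _ _ hj]; exact hθ.1.refl _)
    have e : ∀ c : B, ((subAlg A B hB).op f (y c)).1
        = A.op f (Function.update x i c.1) := by
      intro c
      have : (fun j => (y c j).1) = Function.update x i c.1 := by
        funext j
        by_cases hj : j = i
        · subst hj
          rw [Function.update_self, hy1]
        · rw [Function.update_of_ne hj, hy2 _ _ hj]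
      rw [← this]
      rfl
    obtain ⟨a', b', h1, h2, h3⟩ := ih _ _ h
    exact ⟨a', b', by rw [h1, e], by rw [h2, e], h3⟩

theorem reduced_of_sep {A : AlgStr S} {F B : Set A.α} (hB : Subuniv A B)
    (h : ∀ a ∈ B, ∀ b ∈ B, a ≠ b → ∃ t, Trl A B t ∧ ¬ (t a ∈ F ↔ t b ∈ F)) :
    IsReducedMatrix (subAlg A B hB) (Subtype.val ⁻¹' F) := by
  intro a b
  constructor
  · rintro ⟨θ, hθ, hc, hab⟩
    by_contra hne
    obtain ⟨t, ht, hn⟩ := h a.1 a.2 b.1 b.2 (fun e => hne (Subtype.ext e))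
    obtain ⟨a', b', h1, h2, h3⟩ := trl_cong hB hθ ht a b hab
    apply hn
    rw [← h1, ← h2]
    exact ⟨hc a' b' h3, hc b' a' (hθ.1.symm h3)⟩
  · rintro rfl
    refine ⟨Eq, ⟨⟨fun _ => rfl, fun h => h.symm, fun h1 h2 => h1.trans h2⟩, ?_⟩, ?_, rfl⟩
    · intro f x y hxy
      rw [funext hxy]
    · intro a b e ha; exact e ▸ ha

/-- Arities of the closure signature. -/
def clAr {A : AlgStr S} (X : Set A.α) : X ⊕ (S.F ⊕ (ULift.{u} (ℕ ⊕ ℕ))) → Type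
  | .inl _ => Empty
  | .inr (.inl f) => Fin (S.ar f)
  | .inr (.inr _) => Bool

/-- Operations of the closure signature. -/
def clOp {A : AlgStr S} (X : Set A.α) (d e : A.α → A.α → ℕ → A.α) :
    (Σ c, clAr X c → A.α) → A.α
  | ⟨.inl x, _⟩ => x.1
  | ⟨.inr (.inl f), v⟩ => A.op f v
  | ⟨.inr (.inr ⟨.inl n⟩), v⟩ => d (v true) (v false) n
  | ⟨.inr (.inr ⟨.inr n⟩), v⟩ => e (v true) (v false) n

theorem exists_closure {A : AlgStr S} {κ : Cardinal.{u}}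
    (hκ : Cardinal.aleph0 ≤ κ) (hL : Cardinal.mk S.F ≤ κ) (X : Set A.α)
    (hX : Cardinal.mk X ≤ κ) (d e : A.α → A.α → ℕ → A.α) :
    ∃ B : Set A.α, Subuniv A B ∧ X ⊆ B ∧ Cardinal.mk B ≤ κ ∧
      (∀ a ∈ B, ∀ b ∈ B, Set.range (d a b) ⊆ B) ∧
      (∀ a ∈ B, ∀ b ∈ B, Set.range (e a b) ⊆ B) := by
  let ev := WType.elim (β := clAr X) A.α (clOp X d e)
  refine ⟨Set.range ev, ?_, ?_, ?_, ?_, ?_⟩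
  · intro f x hx
    choose w hw using hx
    refine ⟨WType.mk (.inr (.inl f)) w, ?_⟩
    show A.op f (fun i => ev (w i)) = _
    simp only [hw]
  · intro x hx
    exact ⟨WType.mk (.inl ⟨x, hx⟩) Empty.elim, rfl⟩
  · have fin : ∀ c, Finite (clAr X c) := by
      rintro (x | f | n)
      · exact inferInstanceAs (Finite Empty)
      · exact inferInstanceAs (Finite (Fin _))
      · exact inferInstanceAs (Finite Bool)
    refine Cardinal.mk_range_le.trans
      ((WType.cardinalMk_le_max_aleph0_of_finite').trans (max_le ?_ hκ))
    simp only [Cardinal.lift_uzero, Cardinal.mk_sum, Cardinal.lift_id]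
    refine Cardinal.add_le_of_le hκ hX (Cardinal.add_le_of_le hκ hL ?_)
    exact (Cardinal.mk_le_aleph0).trans hκ
  · rintro _ ⟨a, rfl⟩ _ ⟨b, rfl⟩ _ ⟨n, rfl⟩
    exact ⟨WType.mk (.inr (.inr ⟨.inl n⟩)) (fun c : Bool => if c then a else b), rfl⟩
  · rintro _ ⟨a, rfl⟩ _ ⟨b, rfl⟩ _ ⟨n, rfl⟩
    exact ⟨WType.mk (.inr (.inr ⟨.inr n⟩)) (fun c : Bool => if c then a else b), rfl⟩

/-- for `κ` an infinite cardinal at least the cardinality of the set of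
function symbols, and reduced matrices `⟨A,F⟩`, `⟨A,G⟩`, every `κ`-generated
subalgebra `C` of `A` extends to a `κ`-generated subalgebra `B` such that
`⟨B, F ∩ B⟩` and `⟨B, G ∩ B⟩` are both reduced. -/
theorem extend_to_reduced_subalgebra {S : AlgSig.{u}} (κ : Cardinal.{u})
    (hκ : Cardinal.aleph0 ≤ κ) (hL : Cardinal.mk S.F ≤ κ)
    (A : AlgStr S) (F G : Set A.α)
    (hF : IsReducedMatrix A F) (hG : IsReducedMatrix A G)
    (C : Set A.α) (hCsub : Subuniv A C) (hCgen : KGenerated A κ C) :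
    ∃ (B : Set A.α) (hBsub : Subuniv A B), C ⊆ B ∧ KGenerated A κ B ∧
      IsReducedMatrix (subAlg A B hBsub) (Subtype.val ⁻¹' F) ∧
      IsReducedMatrix (subAlg A B hBsub) (Subtype.val ⁻¹' G) := by
  obtain ⟨X, hX, rfl⟩ := hCgen
  choose d hd using exists_sep hF
  choose e he using exists_sep hG
  obtain ⟨B, hB, hXB, hcard, h1, h2⟩ := exists_closure hκ hL X hX d e
  refine ⟨B, hB, Set.sInter_subset_of_mem ⟨hB, hXB⟩, ⟨B, hcard, ?_⟩, ?_, ?_⟩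
  · exact Set.Subset.antisymm (Set.sInter_subset_of_mem ⟨hB, Set.Subset.rfl⟩)
      (Set.subset_sInter fun _ h => h.2)
  · refine reduced_of_sep hB fun a ha b hb hab => ?_
    obtain ⟨t, ht, hn⟩ := hd a b hab
    exact ⟨t, ht.mono (h1 a ha b hb), hn⟩
  · refine reduced_of_sep hB fun a ha b hb hab => ?_
    obtain ⟨t, ht, hn⟩ := he a b hab
    exact ⟨t, ht.mono (h2 a ha b hb), hn⟩
end

section
/- Suppose the algebraic type has at most countably many function symbols and let L be a logic over it. If the Leibniz operator Ω is injective on Th L, then for every algebra A the Leibniz operator Ω^A is injective on Fi_L A; and if Ω is injective on Th L ∖ {∅}, then for every algebra A the Leibniz operator Ω^A is injective on Fi_L A ∖ {∅}. (For logics in a countable language, the (almost) injectivity of the Leibniz operator transfers from theories to filters over arbitrary algebras.) -/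
universe u

variable {S : AlgSig.{u}}

variable {S : AlgSig.{u}}

section Helpers

/-- Translations of an algebra with parameters in `B`. -/
inductive TrIn (A : AlgStr S) (B : Set A.α) : (A.α → A.α) → Prop
  | id : TrIn A B (fun a => a)
  | comp (p : A.α → A.α) (f : S.F) (z : Fin (S.ar f) → A.α) (i : Fin (S.ar f)) :
      TrIn A B p → (∀ j, z j ∈ B) → TrIn A B (fun a => p (A.op f (Function.update z i a)))

theorem TrIn.mono {A : AlgStr S} {B B' : Set A.α} (h : B ⊆ B') {p : A.α → A.α}
    (hp : TrIn A B p) : TrIn A B' p := by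
  induction hp with
  | id => exact .id
  | comp p f z i _ hz ih => exact .comp p f z i ih fun j => h (hz j)

theorem TrIn.countable {A : AlgStr S} {p : A.α → A.α}
    (hp : TrIn A Set.univ p) : ∃ C : Set A.α, C.Countable ∧ TrIn A C p := by
  induction hp with
  | id => exact ⟨∅, Set.countable_empty, .id⟩
  | comp p f z i _ hz ih =>
    obtain ⟨C, hC, h⟩ := ih
    refine ⟨C ∪ Set.range z, hC.union (Set.countable_range z), .comp p f z i
      (h.mono Set.subset_union_left) fun j => Or.inr ⟨j, rfl⟩⟩

theorem cong_coord {n : ℕ} {α : Type u} (θ : α → α → Prop) (hθ : Equivalence θ)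
    (g : (Fin n → α) → α)
    (h : ∀ z i a b, θ a b → θ (g (Function.update z i a)) (g (Function.update z i b)))
    (x y : Fin n → α) (hxy : ∀ i, θ (x i) (y i)) : θ (g x) (g y) := by
  have key : ∀ s : Finset (Fin n), θ (g x) (g (s.piecewise y x)) := by
    intro s
    induction s using Finset.induction_on with
    | empty => simpa using hθ.refl _
    | insert j s hj ih =>
      refine hθ.trans ih ?_
      rw [Finset.piecewise_insert]
      have := h (s.piecewise y x) j (x j) (y j) (hxy j)
      have e : Function.update (s.piecewise y x) j (x j) = s.piecewise y x := by
        rw [Function.update_eq_self_iff]; simp [hj]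
      rwa [e] at this
  simpa using key Finset.univ

theorem leibniz_of_tr {A : AlgStr S} {F : Set A.α} {x y : A.α}
    (h : ∀ p, TrIn A Set.univ p → (p x ∈ F ↔ p y ∈ F)) : Leibniz A F x y := by
  refine ⟨fun x y => ∀ p, TrIn A Set.univ p → (p x ∈ F ↔ p y ∈ F), ⟨?_, ?_⟩, ?_, h⟩
  · exact ⟨fun _ _ _ => Iff.rfl, fun h p hp => (h p hp).symm,
      fun h h' p hp => (h p hp).trans (h' p hp)⟩
  · intro f x y hxy
    refine cong_coord (fun x y => ∀ p, TrIn A Set.univ p → (p x ∈ F ↔ p y ∈ F)) ?_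
      (A.op f) ?_ x y hxy
    · exact ⟨fun _ _ _ => Iff.rfl, fun h p hp => (h p hp).symm,
        fun h h' p hp => (h p hp).trans (h' p hp)⟩
    · intro z i a b hab p hp
      exact hab _ (.comp p f z i hp fun _ => trivial)
  · intro a b hab ha
    exact (hab _ .id).1 ha

theorem exists_sep_s16 (A : AlgStr S) (F : Set A.α) (x y : A.α) : ∃ w : ℕ → A.α,
    ¬ Leibniz A F x y → ∃ p, TrIn A (Set.range w) p ∧ ¬ (p x ∈ F ↔ p y ∈ F) := by
  by_cases h : Leibniz A F x y
  · exact ⟨fun _ => x, fun h' => absurd h h'⟩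
  · have : ∃ p, TrIn A Set.univ p ∧ ¬ (p x ∈ F ↔ p y ∈ F) := by
      by_contra hc
      refine h (leibniz_of_tr fun p hp => ?_)
      by_contra hn
      exact hc ⟨p, hp, hn⟩
    obtain ⟨p, hp, hn⟩ := this
    obtain ⟨C, hC, hp⟩ := hp.countable
    obtain ⟨w, hw⟩ := (hC.insert x).exists_eq_range ⟨x, Set.mem_insert _ _⟩
    exact ⟨w, fun _ => ⟨p, hp.mono (hw ▸ Set.subset_insert _ _), hn⟩⟩

theorem trm_countable (T : AlgSig.{u}) [Countable T.F] : Countable (Trm T) := by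
  classical
  have : Encodable T.F := Encodable.ofCountable _
  let β : ℕ ⊕ T.F → Type := fun s => Fin (Sum.elim (fun _ => 0) T.ar s)
  have : Countable (WType β) := inferInstance
  let g : WType β → Trm T := fun w => WType.elim (β := β) (Trm T)
    (fun ⟨s, k⟩ => match s, k with
      | .inl n, _ => Trm.var n
      | .inr f, k => Trm.app f k) w
  have hg : Function.Surjective g := by
    intro t
    induction t with
    | var n => exact ⟨.mk (.inl n) (fun i : Fin 0 => i.elim0), rfl⟩
    | app f t ih =>
      choose k hk using ih
      refine ⟨.mk (.inr f) k, ?_⟩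
      change Trm.app f (fun i => g (k i)) = _
      simp [hk]
  exact hg.countable

theorem eval_trmAlg (A : AlgStr S) (v : ℕ → A.α) (σ : ℕ → Trm S) (t : Trm S) :
    Trm.eval A v (Trm.eval (TrmAlg S) σ t) = Trm.eval A (fun n => Trm.eval A v (σ n)) t := by
  induction t with
  | var n => rfl
  | app f t ih =>
    change A.op f (fun i => Trm.eval A v (Trm.eval (TrmAlg S) σ (t i))) = A.op f _
    simp [ih]

theorem theory_preimage (Lo : Logic S) (A : AlgStr S) (F : Set A.α) (hF : IsDedFilter Lo A F)
    (v : ℕ → A.α) : {t | Trm.eval A v t ∈ F} ∈ Theories Lo := by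
  intro Γ φ hφ σ hσ
  have h : Trm.eval A (fun n => Trm.eval A v (σ n)) φ ∈ F :=
    hF Γ φ hφ _ fun γ hγ => (eval_trmAlg A v σ γ) ▸ (hσ γ hγ)
  exact (Set.mem_of_eq_of_mem (eval_trmAlg A v σ φ) h :)

theorem tr_lift (A : AlgStr S) (v : ℕ → A.α) (θ : Trm S → Trm S → Prop)
    (hθ : IsCong (TrmAlg S) θ) (p : A.α → A.α) (hp : TrIn A (Set.range v) p) :
    ∀ s t, θ s t → ∃ s' t', θ s' t' ∧ Trm.eval A v s' = p (Trm.eval A v s) ∧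
      Trm.eval A v t' = p (Trm.eval A v t) := by
  induction hp with
  | id => exact fun s t h => ⟨s, t, h, rfl, rfl⟩
  | comp p f z i _ hz ih =>
    intro s t hst
    choose m hm using hz
    have hev : ∀ r : Trm S, Trm.eval A v
        (Trm.app f (Function.update (fun j => Trm.var (m j)) i r)) =
        A.op f (Function.update z i (Trm.eval A v r)) := by
      intro r
      change A.op f _ = A.op f _
      congr 1
      funext j
      by_cases hj : j = i
      · subst hj; simp
      · simp [hj, Trm.eval, hm]
    obtain ⟨s', t', h, h1, h2⟩ := ih
      (Trm.app f (Function.update (fun j => Trm.var (m j)) i s))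
      (Trm.app f (Function.update (fun j => Trm.var (m j)) i t)) (by
        refine hθ.2 f _ _ fun j => ?_
        by_cases hj : j = i
        · subst hj; simpa using hst
        · simpa [hj] using hθ.1.refl _)
    exact ⟨s', t', h, by rw [h1, hev], by rw [h2, hev]⟩

theorem exists_val (hc : Countable S.F) (A : AlgStr S) (H : Bool → Set A.α) (v₀ : ℕ → A.α) :
    ∃ v : ℕ → A.α, Set.range v₀ ⊆ Set.range v ∧ ∀ b s t,
      Leibniz (TrmAlg S) {r | Trm.eval A v r ∈ H b} s t ↔
        Leibniz A (H b) (Trm.eval A v s) (Trm.eval A v t) := by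
  choose w hw using fun b => exists_sep_s16 A (H b)
  let T : AlgSig.{u} := ⟨S.F ⊕ ULift.{u} (ℕ × Bool), Sum.elim S.ar fun _ => 2⟩
  have : Countable T.F := inferInstanceAs (Countable (S.F ⊕ ULift.{u} (ℕ × Bool)))
  have := trm_countable T
  let A' : AlgStr T := ⟨A.α, fun f => match f with
    | .inl f => A.op f
    | .inr k => fun (x : Fin 2 → A.α) => w k.down.2 (x 0) (x 1) k.down.1⟩
  obtain ⟨v, hv⟩ := (Set.countable_range (Trm.eval A' v₀)).exists_eq_range
    ⟨_, Set.mem_range_self (Trm.var 0)⟩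
  have hop : ∀ f (x : Fin (S.ar f) → A.α), (∀ i, x i ∈ Set.range v) →
      A.op f x ∈ Set.range v := by
    intro f x hx
    rw [← hv] at hx ⊢
    choose k hk using hx
    refine ⟨Trm.app (S := T) (.inl f) k, ?_⟩
    change A.op f (fun i => Trm.eval A' v₀ (k i)) = _
    simp [hk]
  have hwm : ∀ b x y k, x ∈ Set.range v → y ∈ Set.range v → w b x y k ∈ Set.range v := by
    intro b x y k hx hy
    rw [← hv] at hx hy ⊢
    obtain ⟨s, rfl⟩ := hx
    obtain ⟨t, rfl⟩ := hy
    exact ⟨Trm.app (S := T) (.inr ⟨k, b⟩) (![s, t] : Fin 2 → Trm T), rfl⟩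
  have hev : ∀ t, Trm.eval A v t ∈ Set.range v := by
    intro t
    induction t with
    | var n => exact ⟨n, rfl⟩
    | app f t ih => exact hop f _ ih
  refine ⟨v, ?_, ?_⟩
  · rintro _ ⟨n, rfl⟩
    rw [← hv]
    exact ⟨Trm.var n, rfl⟩
  · intro b s t
    constructor
    · rintro ⟨θ, hθ, hcm, hst⟩
      by_contra hn
      obtain ⟨p, hp, hne⟩ := hw b _ _ hn
      obtain ⟨s', t', h, h1, h2⟩ := tr_lift A v θ hθ p (hp.mono (by
        rintro _ ⟨k, rfl⟩
        exact hwm _ _ _ _ (hev s) (hev t))) s t hst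
      apply hne
      rw [← h1, ← h2]
      exact ⟨hcm _ _ h, hcm _ _ (hθ.1.symm h)⟩
    · rintro ⟨θ, hθ, hcm, hst⟩
      refine ⟨fun s t => θ (Trm.eval A v s) (Trm.eval A v t), ⟨⟨fun _ => hθ.1.refl _,
        fun h => hθ.1.symm h, fun h h' => hθ.1.trans h h'⟩, ?_⟩, ?_, hst⟩
      · intro f x y hxy
        exact hθ.2 f _ _ hxy
      · intro a b hab ha
        exact hcm _ _ hab ha

theorem exists_val' (hc : Countable S.F) (A : AlgStr S) (F G : Set A.α) (h : Leibniz A F = Leibniz A G)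
    (v₀ : ℕ → A.α) :
    ∃ v : ℕ → A.α, Set.range v₀ ⊆ Set.range v ∧
      Leibniz (TrmAlg S) {r | Trm.eval A v r ∈ F} =
      Leibniz (TrmAlg S) {r | Trm.eval A v r ∈ G} := by
  obtain ⟨v, h1, h2⟩ := exists_val hc A (fun b => if b then F else G) v₀
  refine ⟨v, h1, ?_⟩
  funext s t
  have a := h2 true s t
  have b := h2 false s t
  simp only [if_true, Bool.false_eq_true, if_false] at a b
  rw [h, ← b] at a
  exact propext a

end Helpers

/-- for a logic in a countable language, the (almost) injectivity of the
Leibniz operator transfers from the theories to the deductive filters over every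
algebra. -/
theorem countable_injectivity_transfer {S : AlgSig.{u}} (hcount : Countable S.F)
    (Lo : Logic S) :
    ((∀ Γ Γ' : Set (Trm S), Γ ∈ Theories Lo → Γ' ∈ Theories Lo →
        Leibniz (TrmAlg S) Γ = Leibniz (TrmAlg S) Γ' → Γ = Γ') →
      ∀ (A : AlgStr S) (F G : Set A.α), IsDedFilter Lo A F → IsDedFilter Lo A G →
        Leibniz A F = Leibniz A G → F = G) ∧
    ((∀ Γ Γ' : Set (Trm S), Γ ∈ Theories Lo → Γ.Nonempty →
        Γ' ∈ Theories Lo → Γ'.Nonempty →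
        Leibniz (TrmAlg S) Γ = Leibniz (TrmAlg S) Γ' → Γ = Γ') →
      ∀ (A : AlgStr S) (F G : Set A.α),
        IsDedFilter Lo A F → F.Nonempty → IsDedFilter Lo A G → G.Nonempty →
        Leibniz A F = Leibniz A G → F = G) := by
  constructor
  · intro hinj A F G hF hG h
    ext a
    obtain ⟨v, hv, hl⟩ := exists_val' hcount A F G h (fun _ => a)
    have e := hinj _ _ (theory_preimage Lo A F hF v) (theory_preimage Lo A G hG v) hl
    obtain ⟨n, rfl⟩ := hv ⟨0, rfl⟩
    exact Set.ext_iff.1 e (Trm.var n)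
  · intro hinj A F G hF ⟨x, hx⟩ hG ⟨y, hy⟩ h
    ext a
    obtain ⟨v, hv, hl⟩ := exists_val' hcount A F G h
      (fun n => if n = 0 then a else if n = 1 then x else y)
    obtain ⟨n, hn⟩ := hv ⟨0, rfl⟩
    obtain ⟨k, hk⟩ := hv ⟨1, rfl⟩
    obtain ⟨m, hm⟩ := hv ⟨2, rfl⟩
    simp at hn hk hm
    subst hn hk hm
    have e := hinj _ _ (theory_preimage Lo A F hF v) ⟨Trm.var k, hx⟩
      (theory_preimage Lo A G hG v) ⟨Trm.var m, hy⟩ hl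
    exact Set.ext_iff.1 e (Trm.var n)
end

section
/- There exist an algebraic type (necessarily uncountable) and a logic L over it such that the Leibniz operator Ω is order-reflecting (and hence injective) on Th L, while for some algebra A the Leibniz operator Ω^A is not injective on Fi_L A. In particular, the injectivity of the Leibniz operator does not in general transfer from theories to filters over arbitrary algebras. -/
universe u

variable {S : AlgSig.{u}}

variable {S : AlgSig.{u}}

namespace ITF

abbrev I : Type u := ULift.{u} ℝ

inductive Sym : Type u
  | c : I.{u} → Sym
  | d : I.{u} → Sym
  | g : Sym
  | f : Sym

def Sg0 : AlgSig.{u} := ⟨Sym.{u}, fun s => match s with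
  | .c _ => 1
  | .d _ => 1
  | .g => 1
  | .f => 2⟩

def cA (A : AlgStr Sg0.{u}) (i : I.{u}) (x : A.α) : A.α := A.op (Sym.c i) (fun _ => x)
def dA (A : AlgStr Sg0.{u}) (i : I.{u}) (x : A.α) : A.α := A.op (Sym.d i) (fun _ => x)
def gA (A : AlgStr Sg0.{u}) (x : A.α) : A.α := A.op Sym.g (fun _ => x)
def fA (A : AlgStr Sg0.{u}) (x y : A.α) : A.α :=
  A.op Sym.f (fun j : Fin 2 => if j = 0 then x else y)

lemma op_c (A : AlgStr Sg0.{u}) (i : I.{u}) (x : Fin 1 → A.α) :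
    A.op (Sym.c i) x = cA A i (x 0) := by
  unfold cA; congr 1; funext j; congr 1; exact Subsingleton.elim (α := Fin 1) j 0
lemma op_d (A : AlgStr Sg0.{u}) (i : I.{u}) (x : Fin 1 → A.α) :
    A.op (Sym.d i) x = dA A i (x 0) := by
  unfold dA; congr 1; funext j; congr 1; exact Subsingleton.elim (α := Fin 1) j 0
lemma op_g (A : AlgStr Sg0.{u}) (x : Fin 1 → A.α) :
    A.op Sym.g x = gA A (x 0) := by
  unfold gA; congr 1; funext j; congr 1; exact Subsingleton.elim (α := Fin 1) j 0
lemma op_f (A : AlgStr Sg0.{u}) (x : Fin 2 → A.α) :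
    A.op Sym.f x = fA A (x 0) (x 1) := by
  unfold fA; congr 1; funext j
  change Fin 2 at j
  fin_cases j <;> rfl

/-- elements depending on the index `i` -/
inductive Dep (A : AlgStr Sg0.{u}) (i : I.{u}) : A.α → Prop
  | c x : Dep A i (A.op (Sym.c i) x)
  | d x : Dep A i (A.op (Sym.d i) x)
  | step h x j : Dep A i (x j) → Dep A i (A.op h x)

lemma Dep.range {A : AlgStr Sg0.{u}} {i : I.{u}} {t : A.α} (h : Dep A i t) :
    ∃ k x, t = A.op k x := by
  cases h <;> exact ⟨_, _, rfl⟩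

structure Proper (A : AlgStr Sg0.{u}) (F : Set A.α) : Prop where
  gc : ∀ i x, gA A (cA A i x) ∈ F
  gd : ∀ i x, gA A (dA A i x) ∈ F ↔ x ∈ F
  nc : ∀ i x, cA A i x ∉ F
  nd : ∀ i x, dA A i x ∉ F
  nf : ∀ s h x, fA A s (A.op h x) ∉ F
  ngg : ∀ x, gA A (gA A x) ∉ F
  ngf : ∀ x y, gA A (fA A x y) ∉ F
  cnt : ∀ y, {i | ∃ t, Dep A i t ∧ fA A t y ∈ F}.Countable

def Good (A : AlgStr Sg0.{u}) (F : Set A.α) : Prop := F = Set.univ ∨ Proper A F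

lemma eval_c (A : AlgStr Sg0.{u}) (v : ℕ → A.α) (i : I.{u}) (x) :
    Trm.eval A v (cA (TrmAlg _) i x) = cA A i (Trm.eval A v x) := rfl
lemma eval_d (A : AlgStr Sg0.{u}) (v : ℕ → A.α) (i : I.{u}) (x) :
    Trm.eval A v (dA (TrmAlg _) i x) = dA A i (Trm.eval A v x) := rfl
lemma eval_g (A : AlgStr Sg0.{u}) (v : ℕ → A.α) (x) :
    Trm.eval A v (gA (TrmAlg _) x) = gA A (Trm.eval A v x) := rfl
lemma eval_f (A : AlgStr Sg0.{u}) (v : ℕ → A.α) (x y) :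
    Trm.eval A v (fA (TrmAlg _) x y) = fA A (Trm.eval A v x) (Trm.eval A v y) := by
  have : Trm.eval A v (fA (TrmAlg _) x y) = A.op Sym.f (fun j : Fin 2 => Trm.eval A v
    (if j = 0 then x else y)) := rfl
  rw [this, op_f]; rfl
lemma eval_op (A : AlgStr Sg0.{u}) (v : ℕ → A.α) (h x) :
    Trm.eval A v ((TrmAlg Sg0).op h x) = A.op h (fun j => Trm.eval A v (x j)) := rfl

lemma Dep.map {A : AlgStr Sg0.{u}} (v : ℕ → A.α) {i : I.{u}} {t : (TrmAlg Sg0.{u}).α}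
    (h : Dep (TrmAlg _) i t) : Dep A i (Trm.eval A v t) := by
  induction h with
  | c x => exact Dep.c _
  | d x => exact Dep.d _
  | step h x j _ ih => exact Dep.step h (fun j => Trm.eval A v (x j)) j ih

lemma Good.preimage {A : AlgStr Sg0.{u}} {F : Set A.α} (hF : Good A F) (v : ℕ → A.α) :
    Good (TrmAlg Sg0.{u}) {t | Trm.eval A v t ∈ F} := by
  rcases hF with rfl | h
  · left; ext; simp
  · right
    constructor
    · intro i x; exact h.gc i _
    · intro i x; exact h.gd i _
    · intro i x; exact h.nc i _
    · intro i x; exact h.nd i _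
    · intro s k x; rw [Set.mem_ofPred_eq, eval_f, eval_op]; exact h.nf _ _ _
    · intro x; exact h.ngg _
    · intro x y; rw [Set.mem_ofPred_eq, eval_g, eval_f]; exact h.ngf _ _
    · intro y
      refine (h.cnt (Trm.eval A v y)).mono ?_
      rintro i ⟨t, ht, hm⟩
      rw [Set.mem_ofPred_eq, eval_f] at hm
      exact ⟨_, ht.map v, hm⟩

lemma Good.sInter {A : AlgStr Sg0.{u}} (X : Set (Set A.α)) (hX : ∀ F ∈ X, Good A F) :
    Good A (⋂₀ X) := by
  by_cases hu : ∀ F ∈ X, F = Set.univ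
  · left; exact Set.sInter_eq_univ.2 hu
  · push Not at hu
    obtain ⟨F, hFX, hFu⟩ := hu
    have hp := (hX F hFX).resolve_left hFu
    right
    constructor
    · intro i x G hG
      rcases hX G hG with rfl | h
      · trivial
      · exact h.gc i x
    · intro i x
      refine forall₂_congr fun G hG => ?_
      rcases hX G hG with rfl | h
      · simp
      · exact h.gd i x
    · intro i x hh; exact hp.nc _ _ (hh F hFX)
    · intro i x hh; exact hp.nd _ _ (hh F hFX)
    · intro i x y hh; exact hp.nf _ _ _ (hh F hFX)
    · intro x hh; exact hp.ngg _ (hh F hFX)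
    · intro i x hh; exact hp.ngf _ _ (hh F hFX)
    · intro y
      refine (hp.cnt y).mono ?_
      rintro i ⟨t, ht, hm⟩
      exact ⟨t, ht, hm F hFX⟩

lemma eval_trm (σ : ℕ → Trm Sg0.{u}) (t : Trm Sg0.{u}) :
    Trm.eval (TrmAlg Sg0.{u}) σ t = Trm.subst σ t := by
  induction t with
  | var n => rfl
  | app f x ih => exact congrArg (Trm.app f) (funext ih)

lemma subst_var (t : Trm Sg0.{u}) : Trm.subst Trm.var t = t := by
  induction t with
  | var n => rfl
  | app f x ih => exact congrArg (Trm.app f) (funext ih)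

def Lg : Logic Sg0.{u} where
  C Γ := ⋂₀ {T | Good (TrmAlg Sg0.{u}) T ∧ Γ ⊆ T}
  monotone := fun Γ Δ h φ hφ T hT => hφ T ⟨hT.1, h.trans hT.2⟩
  extensive := fun Γ φ hφ T hT => hT.2 hφ
  idem := fun Γ φ hφ T hT => hφ T ⟨hT.1, fun ψ hψ => hψ T hT⟩
  structural := by
    rintro σ Γ _ ⟨φ, hφ, rfl⟩ T ⟨hT, hG⟩
    have := hφ _ ⟨hT.preimage σ, fun ψ hψ =>
      (congrArg (· ∈ T) (eval_trm σ ψ)).mpr (hG ⟨ψ, hψ, rfl⟩)⟩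
    exact (congrArg (· ∈ T) (eval_trm σ φ)).mp this

lemma Good.filter {A : AlgStr Sg0.{u}} {F : Set A.α} (hF : Good A F) :
    IsDedFilter Lg.{u} A F := by
  intro Γ φ hφ v hv
  exact hφ _ ⟨hF.preimage v, hv⟩

lemma theory_good {T : Set (Trm Sg0.{u})} (hT : T ∈ Theories Lg.{u}) :
    Good (TrmAlg Sg0.{u}) T := by
  have : T = ⋂₀ {T' | Good (TrmAlg Sg0.{u}) T' ∧ T ⊆ T'} := by
    apply Set.Subset.antisymm
    · exact fun φ hφ T' hT' => hT'.2 hφ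
    · intro φ hφ
      have := hT T φ hφ Trm.var (fun γ hγ => by
        rw [eval_trm, subst_var]; exact hγ)
      rwa [eval_trm, subst_var] at this
  rw [this]
  exact Good.sInter _ fun F hF => hF.1

def th (T : Set (Trm Sg0.{u})) (i : I.{u}) (s t : Trm Sg0.{u}) : Prop :=
  s = t ∨ (Dep (TrmAlg Sg0.{u}) i s ∧ Dep (TrmAlg Sg0.{u}) i t ∧ (s ∈ T ↔ t ∈ T) ∧
    (gA (TrmAlg Sg0.{u}) s ∈ T ↔ gA (TrmAlg Sg0.{u}) t ∈ T))

def Q (T : Set (Trm Sg0.{u})) (s t : Trm Sg0.{u}) : Prop :=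
  (s ∈ T ↔ t ∈ T) ∧ (gA (TrmAlg Sg0.{u}) s ∈ T ↔ gA (TrmAlg Sg0.{u}) t ∈ T)

lemma Q_congr {T : Set (Trm Sg0.{u})} {s s' t t' : Trm Sg0.{u}} (h : s = s') (h' : t = t')
    (H : Q T s' t') : Q T s t := by
  subst h; subst h'; exact H

lemma th_cong {T : Set (Trm Sg0.{u})} (hT : Proper (TrmAlg Sg0.{u}) T) {i : I.{u}}
    (hi : ∀ n t, Dep (TrmAlg Sg0.{u}) i t → fA (TrmAlg Sg0.{u}) t (Trm.var n) ∉ T) :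
    IsCong (TrmAlg Sg0.{u}) (th T i) := by
  have hi' : ∀ t y, Dep (TrmAlg Sg0.{u}) i t → fA (TrmAlg Sg0.{u}) t y ∉ T := by
    intro t y ht
    cases y with
    | var n => exact hi n t ht
    | app h x => exact hT.nf t h x
  have hi2 : ∀ t y, Dep (TrmAlg Sg0.{u}) i y → fA (TrmAlg Sg0.{u}) t y ∉ T := by
    intro t y hy
    obtain ⟨k, x, rfl⟩ := hy.range
    exact hT.nf t k x
  refine ⟨⟨fun _ => Or.inl rfl, ?_, ?_⟩, ?_⟩
  · rintro s t (h | ⟨h1, h2, h3, h4⟩)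
    · exact Or.inl h.symm
    · exact Or.inr ⟨h2, h1, h3.symm, h4.symm⟩
  · rintro s t r (rfl | ⟨h1, h2, h3, h4⟩)
    · exact id
    · rintro (rfl | ⟨k1, k2, k3, k4⟩)
      · exact Or.inr ⟨h1, h2, h3, h4⟩
      · exact Or.inr ⟨h1, k2, h3.trans k3, h4.trans k4⟩
  · intro f x y hxy
    by_cases hall : ∀ j, x j = y j
    · left; rw [funext hall]
    push Not at hall
    obtain ⟨j, hj⟩ := hall
    obtain ⟨h1, h2, -, -⟩ := (hxy j).resolve_left hj
    refine Or.inr ⟨Dep.step _ _ j h1, Dep.step _ _ j h2, ?_⟩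
    cases f with
    | c k =>
      refine Q_congr (op_c _ k x) (op_c _ k y) ?_
      exact ⟨iff_of_false (hT.nc _ _) (hT.nc _ _), iff_of_true (hT.gc _ _) (hT.gc _ _)⟩
    | d k =>
      refine Q_congr (op_d _ k x) (op_d _ k y) ?_
      refine ⟨iff_of_false (hT.nd _ _) (hT.nd _ _), (hT.gd _ _).trans (Iff.trans ?_ (hT.gd _ _).symm)⟩
      rcases hxy (0 : Fin 1) with h | h
      · rw [h]
      · exact h.2.2.1
    | g =>
      refine Q_congr (op_g _ x) (op_g _ y) ?_
      refine ⟨?_, iff_of_false (hT.ngg _) (hT.ngg _)⟩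
      rcases hxy (0 : Fin 1) with h | h
      · rw [h]
      · exact h.2.2.2
    | f =>
      refine Q_congr (op_f _ x) (op_f _ y) ?_
      refine ⟨?_, iff_of_false (hT.ngf _ _) (hT.ngf _ _)⟩
      change Fin 2 at j
      have : j = 0 ∨ j = 1 := by fin_cases j <;> simp
      rcases this with rfl | rfl
      · exact iff_of_false (hi' _ _ h1) (hi' _ _ h2)
      · exact iff_of_false (hi2 _ _ h1) (hi2 _ _ h2)

lemma th_compat (T : Set (Trm Sg0.{u})) (i : I.{u}) : CompatWith (th T i) T := by
  rintro a b (rfl | h)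
  · exact id
  · exact h.2.2.1.1

lemma reflecting (T T' : Set (Trm Sg0.{u})) (hT : T ∈ Theories Lg.{u})
    (hT' : T' ∈ Theories Lg.{u})
    (h : ∀ a b, Leibniz (TrmAlg Sg0.{u}) T a b → Leibniz (TrmAlg Sg0.{u}) T' a b) :
    T ⊆ T' := by
  rcases theory_good hT' with rfl | hp'
  · exact Set.subset_univ _
  intro φ hφ
  obtain ⟨i, hi⟩ : ∃ i : I.{u}, Leibniz (TrmAlg Sg0.{u}) T (cA (TrmAlg _) i φ)
      (dA (TrmAlg _) i φ) := by
    rcases theory_good hT with rfl | hp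
    · exact ⟨⟨0⟩, fun _ _ => True, ⟨⟨fun _ => trivial, fun _ => trivial, fun _ _ => trivial⟩,
        fun _ _ _ _ => trivial⟩, fun _ _ _ _ => trivial, trivial⟩
    · have hc : (⋃ n : ℕ, {i : I.{u} | ∃ t, Dep (TrmAlg Sg0.{u}) i t ∧
          fA (TrmAlg Sg0.{u}) t (Trm.var n) ∈ T}).Countable :=
        Set.countable_iUnion fun n => hp.cnt _
      have hne : ∃ i : I.{u}, i ∉ (⋃ n : ℕ, {i : I.{u} | ∃ t, Dep (TrmAlg Sg0.{u}) i t ∧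
          fA (TrmAlg Sg0.{u}) t (Trm.var n) ∈ T}) := by
        by_contra! hall
        rw [Set.eq_univ_of_forall hall, Set.countable_univ_iff] at hc
        have : Countable ℝ := Equiv.ulift.{u}.symm.injective.countable
        exact not_countable (α := ℝ) this
      obtain ⟨i, hi⟩ := hne
      refine ⟨i, th T i, th_cong hp ?_, th_compat T i, Or.inr ⟨Dep.c _, Dep.d _, ?_, ?_⟩⟩
      · intro n t ht hm
        exact hi (Set.mem_iUnion.2 ⟨n, t, ht, hm⟩)
      · exact iff_of_false (hp.nc _ _) (hp.nd _ _)
      · exact iff_of_true (hp.gc _ _) ((hp.gd _ _).2 hφ)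
  obtain ⟨θ, hθ, hco, hr⟩ := h _ _ hi
  have := hθ.2 Sym.g (fun _ => cA (TrmAlg _) i φ) (fun _ => dA (TrmAlg _) i φ) (fun _ => hr)
  exact (hp'.gd i φ).1 (hco _ _ this (hp'.gc i φ))

inductive B : Type u
  | a : B
  | e : B → B
  | c : I.{u} → B → B
  | d : I.{u} → B → B
  | g : B → B
  | f : B → B → B

def BA : AlgStr Sg0.{u} := ⟨B.{u}, fun h => match h with
  | .c i => fun x => B.c i (x (0 : Fin 1))
  | .d i => fun x => B.d i (x (0 : Fin 1))
  | .g => fun x => B.g (x (0 : Fin 1))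
  | .f => fun x => B.f (x (0 : Fin 2)) (x (1 : Fin 2))⟩

inductive inF (p : Prop) : B.{u} → Prop
  | a : p → inF p B.a
  | f s : inF p (B.f s (B.e s))
  | gc i t : inF p (B.g (B.c i t))
  | gd i t : inF p t → inF p (B.g (B.d i t))

def supp : B.{u} → Set I.{u}
  | .a => ∅
  | .e _ => ∅
  | .c i t => insert i (supp t)
  | .d i t => insert i (supp t)
  | .g t => supp t
  | .f s t => supp s ∪ supp t

lemma supp_countable (t : B.{u}) : (supp t).Countable := by
  induction t with
  | a => exact Set.countable_empty
  | e _ _ => exact Set.countable_empty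
  | c i t ih => exact ih.insert i
  | d i t ih => exact ih.insert i
  | g t ih => exact ih
  | f s t h1 h2 => exact h1.union h2

lemma dep_supp {i : I.{u}} {t : BA.{u}.α} (h : Dep BA.{u} i t) : i ∈ supp t := by
  induction h with
  | c x => exact Set.mem_insert _ _
  | d x => exact Set.mem_insert _ _
  | step h x j _ ih =>
    cases h with
    | c k =>
      obtain rfl : j = (0 : Fin 1) := Subsingleton.elim (α := Fin 1) _ _
      exact Set.mem_insert_of_mem _ ih
    | d k =>
      obtain rfl : j = (0 : Fin 1) := Subsingleton.elim (α := Fin 1) _ _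
      exact Set.mem_insert_of_mem _ ih
    | g =>
      obtain rfl : j = (0 : Fin 1) := Subsingleton.elim (α := Fin 1) _ _
      exact ih
    | f =>
      change Fin 2 at j
      have : j = 0 ∨ j = 1 := by fin_cases j <;> simp
      rcases this with rfl | rfl
      · exact Or.inl ih
      · exact Or.inr ih

lemma inF_proper (p : Prop) : Proper BA.{u} {t | inF p t} := by
  constructor
  · intro i x; exact inF.gc _ _
  · intro i x
    constructor
    · intro h
      change inF p (B.g (B.d i x)) at h
      cases h; assumption
    · intro h; exact inF.gd _ _ h
  · intro i x h
    change inF p (B.c i x) at h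
    cases h
  · intro i x h
    change inF p (B.d i x) at h
    cases h
  · intro s h x hh
    cases h with
    | c k => change inF p (B.f s (B.c _ _)) at hh; cases hh
    | d k => change inF p (B.f s (B.d _ _)) at hh; cases hh
    | g => change inF p (B.f s (B.g _)) at hh; cases hh
    | f => change inF p (B.f s (B.f _ _)) at hh; cases hh
  · intro x h
    change inF p (B.g (B.g x)) at h
    cases h
  · intro x y h
    change inF p (B.g (B.f x y)) at h
    cases h
  · intro y
    have key : ∀ t, inF p (B.f t y) → y = B.e t := by
      intro t h; cases h; rfl
    by_cases hy : ∃ s, y = B.e s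
    · obtain ⟨s, rfl⟩ := hy
      refine (supp_countable s).mono ?_
      rintro i ⟨t, ht, hm⟩
      have := key t hm
      cases this
      exact dep_supp ht
    · convert Set.countable_empty
      ext i
      simp only [Set.mem_ofPred_eq, Set.mem_empty_iff_false, iff_false]
      rintro ⟨t, ht, hm⟩
      exact hy ⟨t, key t hm⟩

lemma inF_leibniz (p : Prop) (s t : B.{u}) : Leibniz BA.{u} {t | inF p t} s t ↔ s = t := by
  constructor
  · rintro ⟨θ, hθ, hco, hr⟩
    have := hθ.2 Sym.f (fun j : Fin 2 => if j = 0 then s else B.e s)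
      (fun j : Fin 2 => if j = 0 then t else B.e s) (by
        intro j
        change Fin 2 at j
        by_cases hj : j = 0
        · simp only [hj, if_true]; exact hr
        · simp only [hj, if_false]; exact hθ.1.refl _)
    have h2 : inF p (B.f t (B.e s)) := hco _ _ this (inF.f s)
    cases h2; rfl
  · rintro rfl
    exact ⟨Eq, ⟨⟨fun _ => rfl, fun h => h.symm, fun h k => h.trans k⟩,
      fun f x y h => by rw [funext h]⟩, fun a b h k => h ▸ k, rfl⟩

lemma uncount : ¬ Countable Sg0.{u}.F := by
  intro h
  have hh : Countable Sym.{u} := h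
  have : Function.Injective (fun r : ℝ => Sym.c.{u} ⟨r⟩) := by
    intro r s hrs
    simpa using hrs
  have : Countable ℝ := this.countable
  exact not_countable (α := ℝ) this

end ITF

/-- there are an (uncountable) algebraic type and a logic over it whose
Leibniz operator is order-reflecting (hence injective) on the theories, while it fails
to be injective on the deductive filters over some algebra: the injectivity of the
Leibniz operator does not transfer in general. -/
theorem injectivity_transfer_fails :
    ∃ (S : AlgSig.{u}) (Lo : Logic S),
      ¬ Countable S.F ∧
      (∀ Γ Γ' : Set (Trm S), Γ ∈ Theories Lo → Γ' ∈ Theories Lo →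
        (∀ a b, Leibniz (TrmAlg S) Γ a b → Leibniz (TrmAlg S) Γ' a b) → Γ ⊆ Γ') ∧
      ∃ (A : AlgStr S) (F G : Set A.α), IsDedFilter Lo A F ∧ IsDedFilter Lo A G ∧
        Leibniz A F = Leibniz A G ∧ F ≠ G := by
  refine ⟨ITF.Sg0, ITF.Lg, ITF.uncount, ITF.reflecting, ITF.BA, {t | ITF.inF True t},
    {t | ITF.inF False t}, ITF.Good.filter (Or.inr (ITF.inF_proper _)),
    ITF.Good.filter (Or.inr (ITF.inF_proper _)), ?_, ?_⟩
  · funext s t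
    exact propext ((ITF.inF_leibniz _ s t).trans (ITF.inF_leibniz _ s t).symm)
  · intro h
    have h1 : ITF.B.a ∈ {t | ITF.inF True t} := ITF.inF.a trivial
    have h2 : ITF.inF False ITF.B.a := by
      have : ITF.B.a ∈ {t | ITF.inF False t} := h ▸ h1
      exact this
    cases h2; assumption
end
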